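/- For every integer n ≥ 33 with n ≡ 9 (mod 12), there exists a sequence of flips of length exactly (3n+3)/2 that transforms the burnt stack Ī_n = [-1, -2, ..., -n] into the sorted stack I_n = [1, 2, ..., n]. -/

import Mathlib

/-- The flip of the top `k` pancakes of a burnt pancake stack `l`. -/
def pancakeFlip (k : ℕ) (l : List ℤ) : List ℤ :=
  ((l.take k).map Neg.neg).reverse ++ l.drop k

/-- Apply a sequence of flips (given by their sizes) successively to a stack. -/
def applyFlips (ks : List ℕ) (l : List ℤ) : List ℤ :=
  ks.foldl (fun s k => pancakeFlip k s) l

/-- The sorted stack `I_n = [1, 2, ..., n]`. -/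
def sortedStack (n : ℕ) : List ℤ := (List.range n).map (fun i => (i : ℤ) + 1)

/-- The reversed burnt stack `Ī_n = [-1, -2, ..., -n]`. -/
def burntStack (n : ℕ) : List ℤ := (List.range n).map (fun i => -((i : ℤ) + 1))

/-- A sequence of flips, each of size between `1` and `n`, transforming `Ī_n` into `I_n`. -/
def IsSortingSeq (n : ℕ) (ks : List ℕ) : Prop :=
  (∀ k ∈ ks, 1 ≤ k ∧ k ≤ n) ∧ applyFlips ks (burntStack n) = sortedStack n

/-- `T n` is the minimum number of flips transforming `Ī_n` into `I_n`. -/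
noncomputable def T (n : ℕ) : ℕ :=
  sInf {m | ∃ ks : List ℕ, IsSortingSeq n ks ∧ ks.length = m}

/-- Turning over a whole stack. -/
def turn (l : List ℤ) : List ℤ := (l.map Neg.neg).reverse

theorem length_turn (l : List ℤ) : (turn l).length = l.length := by simp [turn]

theorem turn_append (l l' : List ℤ) : turn (l ++ l') = turn l' ++ turn l := by simp [turn]

theorem turn_turn (l : List ℤ) : turn (turn l) = l := by simp [turn, List.map_reverse]

theorem pancakeFlip_eq (k : ℕ) (l : List ℤ) :
    pancakeFlip k l = turn (l.take k) ++ l.drop k := rfl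

theorem pancakeFlip_length_self (l : List ℤ) : pancakeFlip l.length l = turn l := by
  simp [pancakeFlip, turn]

theorem length_pancakeFlip (k : ℕ) (l : List ℤ) : (pancakeFlip k l).length = l.length := by
  simp [pancakeFlip]; omega

theorem applyFlips_cons (k : ℕ) (ks : List ℕ) (l : List ℤ) :
    applyFlips (k :: ks) l = applyFlips ks (pancakeFlip k l) := rfl

theorem applyFlips_append (ks ks' : List ℕ) (l : List ℤ) :
    applyFlips (ks ++ ks') l = applyFlips ks' (applyFlips ks l) := by
  simp [applyFlips, List.foldl_append]

theorem length_applyFlips (ks : List ℕ) (l : List ℤ) : (applyFlips ks l).length = l.length := by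
  induction ks generalizing l with
  | nil => rfl
  | cons k ks ih => rw [applyFlips_cons, ih, length_pancakeFlip]

theorem zero_mem_turn (l : List ℤ) : 0 ∈ turn l ↔ 0 ∈ l := by simp [turn]

theorem zero_mem_pancakeFlip (k : ℕ) (l : List ℤ) : 0 ∈ pancakeFlip k l ↔ 0 ∈ l := by
  rw [pancakeFlip_eq, List.mem_append, zero_mem_turn, ← List.mem_append, List.take_append_drop]

theorem zero_mem_applyFlips (ks : List ℕ) (l : List ℤ) : 0 ∈ applyFlips ks l ↔ 0 ∈ l := by
  induction ks generalizing l with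
  | nil => rfl
  | cons k ks ih => rw [applyFlips_cons, ih, zero_mem_pancakeFlip]

/-- Small flips do not touch the bottom part of a stack. -/
theorem applyFlips_append_of_le (ks : List ℕ) (l r : List ℤ) (hk : ∀ k ∈ ks, k ≤ l.length) :
    applyFlips ks (l ++ r) = applyFlips ks l ++ r := by
  induction ks generalizing l with
  | nil => rfl
  | cons k ks ih =>
    have hkl : k ≤ l.length := hk k (by simp)
    have h : pancakeFlip k (l ++ r) = pancakeFlip k l ++ r := by
      simp [pancakeFlip, List.take_append_of_le_length hkl, List.drop_append_of_le_length hkl]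
    rw [applyFlips_cons, applyFlips_cons, h, ih]
    intro j hj
    rw [length_pancakeFlip]
    exact hk j (by simp [hj])

/-- Flips commute with renaming symbols by an odd function. -/
theorem applyFlips_map (g : ℤ → ℤ) (hg : ∀ z, g (-z) = -g z) (ks : List ℕ) (l : List ℤ) :
    applyFlips ks (l.map g) = (applyFlips ks l).map g := by
  induction ks generalizing l with
  | nil => rfl
  | cons k ks ih =>
    rw [applyFlips_cons, applyFlips_cons, ← ih]
    congr 1
    simp [pancakeFlip, List.map_take, List.map_drop, List.map_reverse, Function.comp_def, hg]

/-! ### Inflating the symbols of a stack into blocks -/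

/-- The block named by the absolute value of `z`, turned over when `z` is negative. -/
def orient (f : ℕ → List ℤ) (z : ℤ) : List ℤ :=
  if 0 < z then f z.natAbs else turn (f z.natAbs)

theorem orient_neg (f : ℕ → List ℤ) {z : ℤ} (hz : z ≠ 0) :
    orient f (-z) = turn (orient f z) := by
  unfold orient
  rcases lt_or_gt_of_ne hz with h | h
  · rw [if_pos (by omega), if_neg (by omega), turn_turn, Int.natAbs_neg]
  · rw [if_neg (by omega), if_pos h, Int.natAbs_neg]

/-- Replace every symbol of `σ` by its oriented block. -/
def inflate (f : ℕ → List ℤ) (σ : List ℤ) : List ℤ := σ.flatMap (orient f)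

/-- The total size of the blocks of `σ`, with block sizes given by `w`. -/
def blockSize (w : ℕ → ℕ) (σ : List ℤ) : ℕ := (σ.map fun z => w z.natAbs).sum

theorem inflate_cons (f : ℕ → List ℤ) (z : ℤ) (σ : List ℤ) :
    inflate f (z :: σ) = orient f z ++ inflate f σ := by simp [inflate]

theorem inflate_append (f : ℕ → List ℤ) (σ τ : List ℤ) :
    inflate f (σ ++ τ) = inflate f σ ++ inflate f τ := by simp [inflate]

theorem length_inflate {f : ℕ → List ℤ} {w : ℕ → ℕ} (hf : ∀ i, (f i).length = w i)
    (σ : List ℤ) : (inflate f σ).length = blockSize w σ := by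
  induction σ with
  | nil => rfl
  | cons z σ ih =>
    rw [inflate_cons, List.length_append, ih]
    simp only [blockSize, List.map_cons, List.sum_cons, orient]
    split_ifs <;> simp [length_turn, hf]

theorem inflate_turn (f : ℕ → List ℤ) (σ : List ℤ) (h0 : 0 ∉ σ) :
    inflate f (turn σ) = turn (inflate f σ) := by
  induction σ with
  | nil => rfl
  | cons z σ ih =>
    simp only [List.mem_cons, not_or] at h0
    have : turn (z :: σ) = turn σ ++ [-z] := by simp [turn]
    rw [this, inflate_append, ih h0.2, inflate_cons, inflate_cons, turn_append,
      orient_neg f (Ne.symm h0.1)]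
    simp [inflate]

theorem blockSize_append (w : ℕ → ℕ) (σ τ : List ℤ) :
    blockSize w (σ ++ τ) = blockSize w σ + blockSize w τ := by simp [blockSize]

theorem blockSize_turn (w : ℕ → ℕ) (σ : List ℤ) : blockSize w (turn σ) = blockSize w σ := by
  simp [blockSize, turn, List.map_reverse, List.sum_reverse, Function.comp_def]

theorem blockSize_pancakeFlip (w : ℕ → ℕ) (k : ℕ) (σ : List ℤ) :
    blockSize w (pancakeFlip k σ) = blockSize w σ := by
  rw [pancakeFlip_eq, blockSize_append, blockSize_turn, ← blockSize_append,
    List.take_append_drop]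

theorem blockSize_applyFlips (w : ℕ → ℕ) (ks : List ℕ) (σ : List ℤ) :
    blockSize w (applyFlips ks σ) = blockSize w σ := by
  induction ks generalizing σ with
  | nil => rfl
  | cons k ks ih => rw [applyFlips_cons, ih, blockSize_pancakeFlip]

theorem inflate_pancakeFlip {f : ℕ → List ℤ} {w : ℕ → ℕ} (hf : ∀ i, (f i).length = w i)
    (k : ℕ) (σ : List ℤ) (h0 : 0 ∉ σ) :
    inflate f (pancakeFlip k σ) = pancakeFlip (blockSize w (σ.take k)) (inflate f σ) := by
  have h0' : 0 ∉ σ.take k := fun h => h0 (List.mem_of_mem_take h)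
  have hσ : inflate f σ = inflate f (σ.take k) ++ inflate f (σ.drop k) := by
    rw [← inflate_append, List.take_append_drop]
  rw [pancakeFlip_eq, inflate_append, inflate_turn f _ h0', pancakeFlip_eq, hσ,
    List.take_left' (length_inflate hf _), List.drop_left' (length_inflate hf _)]

/-- The flip sizes on the inflated stack corresponding to the flips `ks` on `σ`. -/
def inflatedFlips (w : ℕ → ℕ) : List ℤ → List ℕ → List ℕ
  | _, [] => []
  | σ, k :: ks => blockSize w (σ.take k) :: inflatedFlips w (pancakeFlip k σ) ks

theorem length_inflatedFlips (w : ℕ → ℕ) (σ : List ℤ) (ks : List ℕ) :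
    (inflatedFlips w σ ks).length = ks.length := by
  induction ks generalizing σ with
  | nil => rfl
  | cons k ks ih => simp [inflatedFlips, ih]

theorem applyFlips_inflatedFlips {f : ℕ → List ℤ} {w : ℕ → ℕ} (hf : ∀ i, (f i).length = w i)
    (ks : List ℕ) (σ : List ℤ) (h0 : 0 ∉ σ) :
    applyFlips (inflatedFlips w σ ks) (inflate f σ) = inflate f (applyFlips ks σ) := by
  induction ks generalizing σ with
  | nil => rfl
  | cons k ks ih =>
    rw [inflatedFlips, applyFlips_cons, applyFlips_cons, ← inflate_pancakeFlip hf k σ h0]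
    exact ih _ (by rwa [zero_mem_pancakeFlip])

theorem mem_inflatedFlips {w : ℕ → ℕ} (hw : ∀ i, 1 ≤ w i) (ks : List ℕ)
    (hks : ∀ k ∈ ks, 1 ≤ k) (σ : List ℤ) (hσ : σ ≠ []) :
    ∀ k ∈ inflatedFlips w σ ks, 1 ≤ k ∧ k ≤ blockSize w σ := by
  induction ks generalizing σ with
  | nil => simp [inflatedFlips]
  | cons j ks ih =>
    intro k hk
    rw [inflatedFlips, List.mem_cons] at hk
    rcases hk with rfl | hk
    · constructor
      · have hj : 1 ≤ j := hks j (by simp)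
        obtain ⟨z, τ, rfl⟩ := List.exists_cons_of_ne_nil hσ
        obtain ⟨i, rfl⟩ := Nat.exists_eq_add_of_le' hj
        simp only [blockSize, List.take_succ_cons, List.map_cons, List.sum_cons]
        exact (hw _).trans (Nat.le_add_right _ _)
      · conv_rhs => rw [← List.take_append_drop j σ, blockSize_append]
        exact Nat.le_add_right _ _
    · rw [← blockSize_pancakeFlip w j σ]
      refine ih (fun i hi => hks i (by simp [hi])) _ ?_ k hk
      rw [← List.length_pos_iff, length_pancakeFlip, List.length_pos_iff]
      exact hσ

/-- Every stack of the right size is an inflation of a given list of distinct names. -/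
theorem exists_flatMap_eq (w : ℕ → ℕ) (ids : List ℕ) (hids : ids.Nodup) (S : List ℤ)
    (hS : S.length = (ids.map w).sum) :
    ∃ f : ℕ → List ℤ, (∀ i, (f i).length = w i) ∧ ids.flatMap f = S := by
  induction ids generalizing S with
  | nil =>
    refine ⟨fun i => List.replicate (w i) 0, by simp, ?_⟩
    simpa [eq_comm] using hS
  | cons i ids ih =>
    rw [List.nodup_cons] at hids
    rw [List.map_cons, List.sum_cons] at hS
    obtain ⟨f, hf, hfS⟩ := ih hids.2 (S.drop (w i)) (by simp; omega)
    refine ⟨Function.update f i (S.take (w i)), fun j => ?_, ?_⟩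
    · by_cases hj : j = i
      · subst hj; simp; omega
      · simp [hj, hf]
    · have : ids.flatMap (Function.update f i (S.take (w i))) = ids.flatMap f := by
        apply List.flatMap_congr
        intro j hj
        rw [Function.update_of_ne]
        rintro rfl
        exact hids.1 hj
      rw [List.flatMap_cons, this, hfS, Function.update_self, List.take_append_drop]

/-- Changing a block whose name does not occur does not change the inflation. -/
theorem inflate_update_of_notMem (f : ℕ → List ℤ) (h : ℕ) (C : List ℤ) (σ : List ℤ)
    (hσ : h ∉ σ.map Int.natAbs) : inflate (Function.update f h C) σ = inflate f σ := by
  apply List.flatMap_congr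
  intro z hz
  have : z.natAbs ≠ h := by
    rintro rfl
    exact hσ (List.mem_map_of_mem hz)
  simp [orient, Function.update_of_ne this]

/-- Turning over `σ` and applying `pre` brings the symbol `h`, upside down, to the top; after
putting it back upright, `post` leads to `σ'`. -/
def IsRound (h : ℕ) (pre post : List ℕ) (σ σ' : List ℤ) : Prop :=
  ∃ R : List ℤ, applyFlips pre (turn σ) = -(h : ℤ) :: R ∧ h ∉ R.map Int.natAbs ∧
    applyFlips post ((h : ℤ) :: R) = σ'

/-- A round on symbols, together with flips `v` of the block named `h`, gives flips of the
inflated stack. -/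
theorem IsRound.exists_flips {h : ℕ} (hh : 0 < h) {pre post : List ℕ} {σ σ' : List ℤ}
    (hr : IsRound h pre post σ σ') (hσ : 0 ∉ σ) {w : ℕ → ℕ} (hw : ∀ i, 1 ≤ w i)
    (hpre : ∀ k ∈ pre, 1 ≤ k) (hpost : ∀ k ∈ post, 1 ≤ k) (v : List ℕ)
    (hv : ∀ k ∈ v, 1 ≤ k ∧ k ≤ w h) :
    ∃ v' : List ℕ, (∀ k ∈ v', 1 ≤ k ∧ k ≤ blockSize w σ) ∧
      v'.length = pre.length + v.length + post.length ∧
      blockSize w σ' = blockSize w σ ∧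
      ∀ f : ℕ → List ℤ, (∀ i, (f i).length = w i) →
        applyFlips v' (turn (inflate f σ)) =
          inflate (Function.update f h (applyFlips v (turn (f h)))) σ' := by
  obtain ⟨R, h₁, hR, h₂⟩ := hr
  have hne : turn σ ≠ [] := by
    rw [← List.length_pos_iff, ← length_applyFlips pre, h₁]
    simp
  have hb₁ : blockSize w (-(h : ℤ) :: R) = blockSize w σ := by
    rw [← h₁, blockSize_applyFlips, blockSize_turn]
  have hb₂ : blockSize w ((h : ℤ) :: R) = blockSize w σ := by
    rw [← hb₁]; simp [blockSize]
  have h0 : (0 : ℤ) ∉ (h : ℤ) :: R := by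
    have : (0 : ℤ) ∉ -(h : ℤ) :: R := by rwa [← h₁, zero_mem_applyFlips, zero_mem_turn]
    simp only [List.mem_cons, not_or] at this ⊢
    exact ⟨by omega, this.2⟩
  refine ⟨inflatedFlips w (turn σ) pre ++ v ++ inflatedFlips w ((h : ℤ) :: R) post,
    ?_, ?_, ?_, ?_⟩
  · intro k hk
    rw [List.mem_append, List.mem_append] at hk
    rcases hk with (hk | hk) | hk
    · have := mem_inflatedFlips hw pre hpre (turn σ) hne k hk
      rwa [blockSize_turn] at this
    · refine ⟨(hv k hk).1, (hv k hk).2.trans ?_⟩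
      rw [← hb₂]
      simp [blockSize]
    · have := mem_inflatedFlips hw post hpost _ (List.cons_ne_nil _ _) k hk
      rwa [hb₂] at this
  · simp [length_inflatedFlips]
    omega
  · rw [← h₂, blockSize_applyFlips, hb₂]
  · intro f hf
    have hf' : ∀ i, (Function.update f h (applyFlips v (turn (f h))) i).length = w i := by
      intro i
      by_cases hi : i = h
      · subst hi
        rw [Function.update_self, length_applyFlips, length_turn, hf]
      · rw [Function.update_of_ne hi, hf]
    have hneg : orient f (-(h : ℤ)) = turn (f h) := by
      rw [orient, if_neg (by omega)]; simp
    have hpos : ∀ g : ℕ → List ℤ, orient g (h : ℤ) = g h := fun g => by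
      rw [orient, if_pos (by omega)]; simp
    rw [applyFlips_append, applyFlips_append, ← inflate_turn f σ hσ,
      applyFlips_inflatedFlips hf pre _ (by rwa [zero_mem_turn]), h₁, inflate_cons, hneg,
      applyFlips_append_of_le _ _ _ (fun k hk => by rw [length_turn, hf]; exact (hv k hk).2),
      ← h₂, ← applyFlips_inflatedFlips hf' post _ h0, inflate_cons, hpos, Function.update_self,
      inflate_update_of_notMem _ _ _ _ hR]

/-! ### Negating a stack in three rounds -/

/-- Three words, each preceded by a flip of the whole stack, negate every stack of size `m`, and
the total number of flips is `3 (m + 1) / 2`. -/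
def HasNegation (m : ℕ) : Prop :=
  ∃ v₁ v₂ v₃ : List ℕ, (∀ k ∈ v₁ ++ v₂ ++ v₃, 1 ≤ k ∧ k ≤ m) ∧
    2 * (v₁.length + v₂.length + v₃.length) + 3 = 3 * m ∧
    ∀ B : List ℤ, B.length = m →
      applyFlips v₃ (turn (applyFlips v₂ (turn (applyFlips v₁ (turn B))))) = B.map Neg.neg

/-- The names `1, …, N`. -/
def names (N : ℕ) : List ℕ := (List.range N).map (· + 1)

theorem nodup_names (N : ℕ) : (names N).Nodup :=
  List.nodup_range.map (add_left_injective 1)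

theorem inflate_map_names (f : ℕ → List ℤ) (N : ℕ) :
    inflate f ((names N).map Nat.cast) = (names N).flatMap f := by
  rw [inflate, List.flatMap_map]
  apply List.flatMap_congr
  intro i hi
  have : 0 < i := by
    obtain ⟨j, -, rfl⟩ := List.mem_map.1 hi
    omega
  rw [orient, if_pos (by omega), Int.natAbs_natCast]

theorem sum_map_names (N h b : ℕ) (hh : h ∈ names N) :
    ((names N).map fun i => if i = h then b else 1).sum + 1 = N + b := by
  have key : ∀ l : List ℕ, l.Nodup →
      (l.map fun i => if i = h then b else 1).sum + (if h ∈ l then 1 else 0) =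
        l.length + if h ∈ l then b else 0 := by
    intro l
    induction l with
    | nil => simp
    | cons i l ih =>
      intro hl
      rw [List.nodup_cons] at hl
      have := ih hl.2
      by_cases hi : i = h
      · subst hi
        simp [hl.1] at this ⊢
        omega
      · have hi' : h ≠ i := Ne.symm hi
        simp [hi, hi'] at this ⊢
        omega
  have := key _ (nodup_names N)
  rw [if_pos hh, if_pos hh] at this
  simpa only [names, List.length_map, List.length_range] using this

theorem HasNegation.inflate {b N h : ℕ} (H : HasNegation b) (hb : 1 ≤ b) (hh : h ∈ names N)
    {pre post : List ℕ} (hpre : ∀ k ∈ pre, 1 ≤ k) (hpost : ∀ k ∈ post, 1 ≤ k)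
    (hlen : 2 * (pre.length + post.length) + 1 = N) {σ₁ σ₂ : List ℤ}
    (r₁ : IsRound h pre post ((names N).map Nat.cast) σ₁)
    (r₂ : IsRound h pre post σ₁ σ₂)
    (r₃ : IsRound h pre post σ₂
      ((names N).map fun i : ℕ => if i = h then (i : ℤ) else -(i : ℤ)))
    (h₁ : 0 ∉ σ₁) (h₂ : 0 ∉ σ₂) :
    HasNegation (b + (N - 1)) := by
  obtain ⟨v₁, v₂, v₃, hv, hvl, hvB⟩ := H
  have pos : ∀ i ∈ names N, 0 < i := by
    intro i hi
    obtain ⟨j, -, rfl⟩ := List.mem_map.1 hi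
    omega
  have hh0 : 0 < h := pos h hh
  let w : ℕ → ℕ := fun i => if i = h then b else 1
  have hwh : w h = b := by simp [w]
  have hw : ∀ i, 1 ≤ w i := by
    intro i
    simp only [w]
    split_ifs <;> omega
  have h₀ : (0 : ℤ) ∉ (names N).map Nat.cast := by
    intro hmem
    obtain ⟨i, hi, hi0⟩ := List.mem_map.1 hmem
    have := pos i hi
    omega
  have hs : ((names N).map w).sum = b + (N - 1) := by
    have := sum_map_names N h b hh
    simp only [w]
    omega
  have hsize : blockSize w ((names N).map Nat.cast) = b + (N - 1) := by
    rw [← hs]; simp [blockSize, Function.comp_def]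
  obtain ⟨u₁, hu₁, hl₁, hs₁, hf₁⟩ := r₁.exists_flips hh0 h₀ hw hpre hpost v₁
    (fun k hk => hwh.symm ▸ hv k (by simp [hk]))
  obtain ⟨u₂, hu₂, hl₂, hs₂, hf₂⟩ := r₂.exists_flips hh0 h₁ hw hpre hpost v₂
    (fun k hk => hwh.symm ▸ hv k (by simp [hk]))
  obtain ⟨u₃, hu₃, hl₃, -, hf₃⟩ := r₃.exists_flips hh0 h₂ hw hpre hpost v₃
    (fun k hk => hwh.symm ▸ hv k (by simp [hk]))
  rw [hs₂] at hu₃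
  rw [hs₁] at hu₂ hu₃
  rw [hsize] at hu₁ hu₂ hu₃
  refine ⟨u₁, u₂, u₃, ?_, by omega, ?_⟩
  · intro k hk
    rw [List.mem_append, List.mem_append] at hk
    rcases hk with (hk | hk) | hk
    exacts [hu₁ k hk, hu₂ k hk, hu₃ k hk]
  · intro S hS
    obtain ⟨f, hf, hfS⟩ := exists_flatMap_eq w (names N) (nodup_names N) S (by rw [hS, hs])
    have hup : ∀ (g : ℕ → List ℤ) (v : List ℕ), (∀ i, (g i).length = w i) →
        ∀ i, (Function.update g h (applyFlips v (turn (g h))) i).length = w i := by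
      intro g v hg i
      by_cases hi : i = h
      · subst hi
        rw [Function.update_self, length_applyFlips, length_turn, hg]
      · rw [Function.update_of_ne hi, hg]
    have hneg := hvB (f h) (by rw [hf, hwh])
    conv_lhs => rw [← hfS, ← inflate_map_names]
    rw [hf₁ f hf, hf₂ _ (hup _ _ hf), hf₃ _ (hup _ _ (hup _ _ hf))]
    simp only [Function.update_self, Function.update_idem, hneg]
    rw [← hfS, _root_.inflate, List.flatMap_map, List.map_flatMap]
    apply List.flatMap_congr
    intro i hi
    have hi0 := pos i hi
    by_cases hih : i = h
    · subst hih
      simp [orient, hi0]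
    · have hlen1 : (f i).length = 1 := by rw [hf]; simp [w, hih]
      obtain ⟨a, ha⟩ := List.length_eq_one_iff.1 hlen1
      rw [if_neg hih, orient, if_neg (by omega), Int.natAbs_neg, Int.natAbs_natCast,
        Function.update_of_ne hih, ha]
      rfl

/-- It suffices to check that a word negates one stack. -/
theorem hasNegation_of_names {m : ℕ} (v : List ℕ) (hv : ∀ k ∈ v, 1 ≤ k ∧ k ≤ m)
    (hl : 2 * v.length + 1 = m)
    (h : applyFlips v (turn (applyFlips v (turn (applyFlips v (turn ((names m).map Nat.cast)))))) =
      (names m).map fun i : ℕ => -(i : ℤ)) : HasNegation m := by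
  refine ⟨v, v, v, ?_, by omega, ?_⟩
  · intro k hk
    exact hv k (by simpa using hk)
  · intro B hB
    let g : ℤ → ℤ := fun z => z.sign * B.getD (z.natAbs - 1) 0
    have hg : ∀ z, g (-z) = -g z := by intro z; simp [g]
    have hturn : ∀ l : List ℤ, turn (l.map g) = (turn l).map g := by
      intro l
      simp [turn, List.map_reverse, Function.comp_def, hg]
    have hgB : ((names m).map Nat.cast).map g = B := by
      apply List.ext_getElem
      · simp [names, hB]
      · intro i h₁ h₂
        have hi : ((i : ℤ) + 1).natAbs - 1 = i := by omega
        have hsign : ((i : ℤ) + 1).sign = 1 := Int.sign_eq_one_of_pos (by omega)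
        simp [names, g, h₂, hi, hsign]
    rw [← hgB]
    simp only [hturn, applyFlips_map g hg, h]
    simp [Function.comp_def, hg]

theorem hasNegation_three : HasNegation 3 :=
  hasNegation_of_names [2] (by decide) rfl (by decide)

theorem hasNegation_fifteen : HasNegation 15 :=
  hasNegation_of_names [10, 4, 6, 14, 6, 4, 10] (by decide) rfl (by decide)

set_option maxRecDepth 10000 in
theorem hasNegation_twentySeven : HasNegation 27 :=
  hasNegation_of_names [18, 7, 4, 13, 15, 12, 26, 12, 15, 13, 4, 7, 18] (by decide) rfl
    (by decide)

theorem isRound_of_tail {h : ℕ} {pre post : List ℕ} {σ σ' : List ℤ}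
    (h₁ : applyFlips pre (turn σ) = -(h : ℤ) :: (applyFlips pre (turn σ)).tail)
    (h₂ : h ∉ (applyFlips pre (turn σ)).tail.map Int.natAbs)
    (h₃ : applyFlips post ((h : ℤ) :: (applyFlips pre (turn σ)).tail) = σ') :
    IsRound h pre post σ σ' := ⟨_, h₁, h₂, h₃⟩

theorem HasNegation.add_thirty {b : ℕ} (H : HasNegation b) (hb : 1 ≤ b) :
    HasNegation (b + 30) :=
  H.inflate (N := 31) (h := 9) hb (by decide)
    (pre := [18, 8, 28, 6]) (post := [18, 4, 14, 8, 4, 22, 6, 24, 30, 4, 16])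
    (by decide) (by decide) rfl
    (σ₁ := [26, 27, 6, 7, -15, -14, 22, 23, 9, -8, 18, 19, 2, 3, -21, -20, -25, -24, 28, 29,
      -5, -4, 10, 11, 30, 31, -13, -12, 16, 17, -1])
    (σ₂ := [31, -13, -14, 22, 21, -3, -4, 10, 9, -23, -24, 28, 27, 6, 5, -29, -30, -11, -12,
      16, 15, -7, -8, 18, 17, -1, -2, -19, -20, -25, -26])
    (isRound_of_tail (by decide) (by decide) (by decide))
    (isRound_of_tail (by decide) (by decide) (by decide))
    (isRound_of_tail (by decide) (by decide) (by decide))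
    (by decide) (by decide)

theorem HasNegation.add_thirtySix {b : ℕ} (H : HasNegation b) (hb : 1 ≤ b) :
    HasNegation (b + 36) :=
  H.inflate (N := 37) (h := 9) hb (by decide)
    (pre := [24, 12, 34, 6])
    (post := [20, 4, 16, 28, 2, 32, 2, 28, 6, 14, 36, 20, 4, 32])
    (by decide) (by decide) rfl
    (σ₁ := [30, 31, 6, 7, -15, -14, 26, 27, 9, -8, 34, 35, 2, 3, -25, -24, 18, 19, -17, -16,
      22, 23, -21, -20, -5, -4, 10, 11, 36, 37, -13, -12, -29, -28, 32, 33, -1])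
    (σ₂ := [37, -13, -14, 26, 25, -3, -4, 10, 9, -27, -28, 32, 31, 6, 5, 20, 19, -17, -18, 24,
      23, -21, -22, 16, 15, -7, -8, 34, 33, -1, -2, -35, -36, -11, -12, -29, -30])
    (isRound_of_tail (by decide) (by decide) (by decide))
    (isRound_of_tail (by decide) (by decide) (by decide))
    (isRound_of_tail (by decide) (by decide) (by decide))
    (by decide) (by decide)

theorem hasNegation_of_mod_twelve (m : ℕ) (hm : m % 12 = 3) : HasNegation m := by
  induction m using Nat.strong_induction_on with
  | _ m ih =>
    by_cases h : m < 39
    · have : m = 3 ∨ m = 15 ∨ m = 27 := by omega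
      rcases this with rfl | rfl | rfl
      exacts [hasNegation_three, hasNegation_fifteen, hasNegation_twentySeven]
    · have := (ih (m - 36) (by omega) (by omega)).add_thirtySix (by omega)
      rwa [Nat.sub_add_cancel (by omega)] at this

/-- For every integer `n ≥ 33` with `n ≡ 9 (mod 12)`, there exists a sequence of flips of
length exactly `(3n+3)/2` transforming `Ī_n` into `I_n`. -/
theorem exists_sorting_seq_nine_mod_twelve (n : ℕ) (hn : 33 ≤ n) (hmod : n % 12 = 9) :
    ∃ ks : List ℕ, IsSortingSeq n ks ∧ ks.length = (3 * n + 3) / 2 := by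
  have H := (hasNegation_of_mod_twelve (n - 30) (by omega)).add_thirty (by omega)
  rw [Nat.sub_add_cancel (by omega)] at H
  obtain ⟨v₁, v₂, v₃, hv, hl, hB⟩ := H
  have hturn : ∀ l : List ℤ, l.length = n → pancakeFlip n l = turn l := by
    rintro l rfl
    exact pancakeFlip_length_self l
  have hlen : (burntStack n).length = n := by simp [burntStack]
  refine ⟨n :: v₁ ++ (n :: v₂ ++ n :: v₃), ⟨?_, ?_⟩, ?_⟩
  · intro k hk
    have hk' : k = n ∨ k ∈ v₁ ++ v₂ ++ v₃ := by
      simp only [List.mem_append, List.mem_cons] at hk ⊢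
      tauto
    rcases hk' with rfl | hk'
    exacts [⟨by omega, le_rfl⟩, hv k hk']
  · rw [applyFlips_append, applyFlips_append, applyFlips_cons, applyFlips_cons, applyFlips_cons,
      hturn _ hlen,
      hturn (applyFlips v₁ _) (by rw [length_applyFlips, length_turn, hlen]),
      hturn _ (by rw [length_applyFlips, length_turn, length_applyFlips, length_turn, hlen]), hB _ hlen]
    simp [burntStack, sortedStack, Function.comp_def]
  · simp only [List.length_append, List.length_cons]
    omega
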